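/- arXiv:2202.00854 — 2 statements merged into one kernel-verified Lean document; each statement's English description precedes it below -/
import Mathlib

section
/- A proper Helly circular-arc graph G is a proper interval graph if and only if G contains no hole (no induced cycle of length at least 4). -/
/-! Common definitions: arc/interval representations, graph classes,
induced subgraph containment, small named graphs, reduced graphs. -/

/-- The point of the unit circle corresponding to parameter `t`. -/
noncomputable def circlePt (t : ℝ) : ℝ × ℝ :=
  (Real.cos (2 * Real.pi * t), Real.sin (2 * Real.pi * t))

/-- A (nonempty closed) arc of the unit circle: the image under
`t ↦ (cos 2πt, sin 2πt)` of a closed interval `[a, b] ⊆ ℝ` with `0 ≤ b - a < 1`. -/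
def IsUnitCircleArc (A : Set (ℝ × ℝ)) : Prop :=
  ∃ a b : ℝ, 0 ≤ b - a ∧ b - a < 1 ∧ A = circlePt '' Set.Icc a b

/-- An arc representation of a graph: each vertex gets an arc of the unit circle,
and two distinct vertices are adjacent iff their arcs intersect. -/
def IsArcRep {V : Type*} (G : SimpleGraph V) (f : V → Set (ℝ × ℝ)) : Prop :=
  (∀ v, IsUnitCircleArc (f v)) ∧
    ∀ u v : V, u ≠ v → (G.Adj u v ↔ (f u ∩ f v).Nonempty)

/-- A family of sets is proper if no member is properly contained in another. -/
def ProperFamily {V α : Type*} (f : V → Set α) : Prop :=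
  ∀ u v : V, ¬ f u ⊂ f v

/-- A family of sets is Helly if every subfamily of pairwise intersecting sets
has a common point. -/
def HellyFamily {V α : Type*} (f : V → Set α) : Prop :=
  ∀ S : Set V, (∀ u ∈ S, ∀ v ∈ S, (f u ∩ f v).Nonempty) → (⋂ v ∈ S, f v).Nonempty

/-- A proper circular-arc graph: admits an arc representation with no arc
properly contained in another. -/
def IsProperCircularArcGraph {V : Type*} (G : SimpleGraph V) : Prop :=
  ∃ f : V → Set (ℝ × ℝ), IsArcRep G f ∧ ProperFamily f

/-- A proper Helly circular-arc graph: admits an arc representation that is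
simultaneously proper and Helly. -/
def IsProperHellyCircularArcGraph {V : Type*} (G : SimpleGraph V) : Prop :=
  ∃ f : V → Set (ℝ × ℝ), IsArcRep G f ∧ ProperFamily f ∧ HellyFamily f

/-- An interval representation: each vertex gets a nonempty closed bounded
interval of ℝ; distinct vertices adjacent iff intervals intersect. -/
def IsIntervalRep {V : Type*} (G : SimpleGraph V) (f : V → Set ℝ) : Prop :=
  (∀ v, ∃ a b : ℝ, a ≤ b ∧ f v = Set.Icc a b) ∧
    ∀ u v : V, u ≠ v → (G.Adj u v ↔ (f u ∩ f v).Nonempty)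

def IsIntervalGraph {V : Type*} (G : SimpleGraph V) : Prop :=
  ∃ f : V → Set ℝ, IsIntervalRep G f

def IsProperIntervalGraph {V : Type*} (G : SimpleGraph V) : Prop :=
  ∃ f : V → Set ℝ, IsIntervalRep G f ∧ ProperFamily f

/-- A graph is bipartite: its vertices can be partitioned into two independent sets. -/
def IsBipartite {V : Type*} (G : SimpleGraph V) : Prop :=
  ∃ c : V → Bool, ∀ u v : V, G.Adj u v → c u ≠ c v

/-- A permutation graph. -/
def IsPermutationGraph {V : Type*} (G : SimpleGraph V) : Prop :=
  ∃ a b : V → ℝ, Function.Injective a ∧ Function.Injective b ∧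
    ∀ u v : V, u ≠ v → (G.Adj u v ↔ (a u - a v) * (b u - b v) < 0)

def IsBipartitePermutationGraph {V : Type*} (G : SimpleGraph V) : Prop :=
  IsPermutationGraph G ∧ IsBipartite G

/-- `f : ZMod ℓ → V` is an induced (chordless) cycle of length `ℓ ≥ 3` in `G`:
`f` is injective and two images are adjacent iff their indices are consecutive mod `ℓ`. -/
def IsInducedCycle {V : Type*} (G : SimpleGraph V) (ℓ : ℕ) (f : ZMod ℓ → V) : Prop :=
  3 ≤ ℓ ∧ Function.Injective f ∧
    ∀ i j : ZMod ℓ, G.Adj (f i) (f j) ↔ (i = j + 1 ∨ j = i + 1)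

/-- `G` contains `H` as an induced subgraph. -/
def ContainsInduced {V W : Type*} (G : SimpleGraph V) (H : SimpleGraph W) : Prop :=
  ∃ f : W → V, Function.Injective f ∧ ∀ u v : W, H.Adj u v ↔ G.Adj (f u) (f v)

/-- `G` contains `C_ℓ*`: an induced cycle of length `ℓ` together with a vertex
adjacent to no vertex of the cycle. -/
def HasCycleStar {V : Type*} (G : SimpleGraph V) (ℓ : ℕ) : Prop :=
  ∃ (f : ZMod ℓ → V) (v : V), IsInducedCycle G ℓ f ∧ ∀ i : ZMod ℓ, ¬ G.Adj v (f i)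

/-- A maximal clique. -/
def IsMaxClique {V : Type*} (G : SimpleGraph V) (s : Set V) : Prop :=
  G.IsClique s ∧ ∀ t : Set V, G.IsClique t → s ⊆ t → t = s

/-- A clique path: a linear arrangement of all maximal cliques of `G` such that
the cliques containing any fixed vertex are consecutive. -/
def IsCliquePath {W : Type*} (G : SimpleGraph W) (q : ℕ) (K : Fin q → Set W) : Prop :=
  Function.Injective K ∧ (∀ i, IsMaxClique G (K i)) ∧
    (∀ s : Set W, IsMaxClique G s → ∃ i, K i = s) ∧
    ∀ (v : W) (i j k : Fin q), i ≤ j → j ≤ k → v ∈ K i → v ∈ K k → v ∈ K j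

/-- A circular interval of residues mod `n`: `{p, p+1, …, p+m}`. -/
def IsCircInterval {n : ℕ} (s : Set (ZMod n)) : Prop :=
  ∃ (p : ZMod n) (m : ℕ), s = {x : ZMod n | ∃ k : ℕ, k ≤ m ∧ x = p + (k : ZMod n)}

/-! ### Small named graphs -/

/-- The claw `K_{1,3}`. -/
def clawG : SimpleGraph (Fin 4) := SimpleGraph.fromRel (fun u _ => u = 0)

/-- The net: a triangle `{0,1,2}` with pendant vertices `3,4,5` attached to
`0,1,2` respectively. -/
def netG : SimpleGraph (Fin 6) :=
  SimpleGraph.fromRel (fun u v => (u.val < 3 ∧ v.val < 3) ∨ v.val = u.val + 3)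

/-- The tent `S_3`: triangle `{0,1,2}`, independent set `{3,4,5}`, with
`3 ~ 0,1`, `4 ~ 1,2`, `5 ~ 2,0`. -/
def tentS3 : SimpleGraph (Fin 6) :=
  SimpleGraph.fromRel (fun u v =>
    (u.val < 3 ∧ v.val < 3) ∨ (u = 3 ∧ (v = 0 ∨ v = 1)) ∨
      (u = 4 ∧ (v = 1 ∨ v = 2)) ∨ (u = 5 ∧ (v = 2 ∨ v = 0)))

/-- `S_3*`: the tent together with an isolated vertex `6`. -/
def S3star : SimpleGraph (Fin 7) :=
  SimpleGraph.fromRel (fun u v =>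
    (u.val < 3 ∧ v.val < 3) ∨ (u = 3 ∧ (v = 0 ∨ v = 1)) ∨
      (u = 4 ∧ (v = 1 ∨ v = 2)) ∨ (u = 5 ∧ (v = 2 ∨ v = 0)))

/-- The complement of `S_3*`. -/
def compS3star : SimpleGraph (Fin 7) := S3starᶜ

/-- The complement of `C_4*`: two edges `0-2`, `1-3` plus a universal vertex `4`. -/
def compC4star : SimpleGraph (Fin 5) :=
  SimpleGraph.fromRel (fun u v => (u = 0 ∧ v = 2) ∨ (u = 1 ∧ v = 3) ∨ u = 4)

/-- The chordless cycle `C_6`. -/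
def cycle6G : SimpleGraph (Fin 6) :=
  SimpleGraph.fromRel (fun u v => v.val = (u.val + 1) % 6)

/-- The complement of `C_6`. -/
def compC6 : SimpleGraph (Fin 6) := cycle6Gᶜ

/-- The wheel `W_4`: a `C_4` on `{0,1,2,3}` plus a hub `4`. -/
def W4G : SimpleGraph (Fin 5) :=
  SimpleGraph.fromRel (fun u v => (u.val < 4 ∧ v.val = (u.val + 1) % 4) ∨ v = 4)

/-- The wheel `W_5`: a `C_5` on `{0,…,4}` plus a hub `5`. -/
def W5G : SimpleGraph (Fin 6) :=
  SimpleGraph.fromRel (fun u v => (u.val < 5 ∧ v.val = (u.val + 1) % 5) ∨ v = 5)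

/-- `F_1` (the long claw): the claw with each edge subdivided once. -/
def F1G : SimpleGraph (Fin 7) :=
  SimpleGraph.fromRel (fun u v =>
    (u = 0 ∧ v = 1) ∨ (u = 1 ∧ v = 2) ∨ (u = 0 ∧ v = 3) ∨ (u = 3 ∧ v = 4) ∨
      (u = 0 ∧ v = 5) ∨ (u = 5 ∧ v = 6))

/-- `F_2`: a `C_4` `0-1-2-3-0` with pendant vertices `4,5,6` attached to `0,2,3`. -/
def F2G : SimpleGraph (Fin 7) :=
  SimpleGraph.fromRel (fun u v =>
    (u = 0 ∧ v = 1) ∨ (u = 1 ∧ v = 2) ∨ (u = 2 ∧ v = 3) ∨ (u = 3 ∧ v = 0) ∨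
      (u = 0 ∧ v = 4) ∨ (u = 2 ∧ v = 5) ∨ (u = 3 ∧ v = 6))

/-- `F_3`: a `C_6` `0-1-2-3-4-5-0` with chord `0-3` and pendant `6` at `0`. -/
def F3G : SimpleGraph (Fin 7) :=
  SimpleGraph.fromRel (fun u v =>
    (u.val < 6 ∧ v.val = (u.val + 1) % 6) ∨ (u = 0 ∧ v = 3) ∨ (u = 0 ∧ v = 6))

/-- `F_4`: a `C_6` `0-1-2-3-4-5-0` with chord `0-3` and a vertex `6` adjacent
exactly to `0` and `3`. -/
def F4G : SimpleGraph (Fin 7) :=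
  SimpleGraph.fromRel (fun u v =>
    (u.val < 6 ∧ v.val = (u.val + 1) % 6) ∨ (u = 0 ∧ v = 3) ∨ (u = 6 ∧ (v = 0 ∨ v = 3)))

/-- A reduced graph: connected, co-connected, and containing none of
`C_3*`, `C_5*`, the complement of `C_4*`, `C_6`, `S_3`, the complement of `S_3*`,
`F_1`, `F_2`, `F_3`, `F_4` as induced subgraphs. -/
def IsReducedGraph {V : Type*} (R : SimpleGraph V) : Prop :=
  R.Connected ∧ Rᶜ.Connected ∧
    ¬ HasCycleStar R 3 ∧ ¬ HasCycleStar R 5 ∧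
    ¬ ContainsInduced R compC4star ∧
    ¬ (∃ f : ZMod 6 → V, IsInducedCycle R 6 f) ∧
    ¬ ContainsInduced R tentS3 ∧
    ¬ ContainsInduced R compS3star ∧
    ¬ ContainsInduced R F1G ∧ ¬ ContainsInduced R F2G ∧
    ¬ ContainsInduced R F3G ∧ ¬ ContainsInduced R F4G

theorem circlePt_eq_iff {s t : ℝ} : circlePt s = circlePt t ↔ ∃ n : ℤ, s = t + n := by
  constructor
  · intro h
    obtain ⟨hc, hs⟩ := Prod.mk.inj h
    obtain ⟨k, hk⟩ := Real.Angle.angle_eq_iff_two_pi_dvd_sub.1 (Real.Angle.cos_sin_inj hc hs)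
    refine ⟨k, ?_⟩
    have hpi := Real.two_pi_pos
    have h0 : 2 * Real.pi * (s - t - k) = 0 := by linarith
    rcases mul_eq_zero.1 h0 with h1 | h1 <;> linarith
  · rintro ⟨n, rfl⟩
    have h : 2 * Real.pi * (t + n) = 2 * Real.pi * t + n * (2 * Real.pi) := by ring
    simp only [circlePt, h, Real.cos_add_int_mul_two_pi, Real.sin_add_int_mul_two_pi]

/-- A family of arcs on a circle of circumference one, given by real endpoints, representing `G`:
adjacency is intersection up to integer translation, no arc properly contains another,
and three pairwise intersecting arcs have a common point. -/
structure ArcLift {V : Type*} (G : SimpleGraph V) where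
  /-- The left endpoint. -/
  lo : V → ℝ
  /-- The right endpoint. -/
  hi : V → ℝ
  lo_le_hi : ∀ v, lo v ≤ hi v
  hi_lt : ∀ v, hi v < lo v + 1
  adj_iff : ∀ u v, u ≠ v → (G.Adj u v ↔ ∃ n : ℤ, lo u + n ≤ hi v ∧ lo v ≤ hi u + n)
  proper : ∀ u v (n : ℤ), lo v ≤ lo u + n → hi u + n ≤ hi v → lo v = lo u + n ∧ hi u + n = hi v
  helly : ∀ u v w, (∃ n : ℤ, lo u + n ≤ hi v ∧ lo v ≤ hi u + n) →
    (∃ n : ℤ, lo v + n ≤ hi w ∧ lo w ≤ hi v + n) →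
    (∃ n : ℤ, lo u + n ≤ hi w ∧ lo w ≤ hi u + n) →
    ∃ (t : ℝ) (k m n : ℤ), (lo u ≤ t + k ∧ t + k ≤ hi u) ∧ (lo v ≤ t + m ∧ t + m ≤ hi v) ∧
      (lo w ≤ t + n ∧ t + n ≤ hi w)

theorem circlePt_image_inter_nonempty_iff {a b c d : ℝ} (hab : a ≤ b) (hcd : c ≤ d) :
    (circlePt '' Set.Icc a b ∩ circlePt '' Set.Icc c d).Nonempty ↔
      ∃ n : ℤ, a + n ≤ d ∧ c ≤ b + n := by
  constructor
  · rintro ⟨x, ⟨s, ⟨hs1, hs2⟩, rfl⟩, ⟨t, ⟨ht1, ht2⟩, hst⟩⟩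
    obtain ⟨n, hn⟩ := circlePt_eq_iff.1 hst
    exact ⟨n, by linarith, by linarith⟩
  · rintro ⟨n, h1, h2⟩
    refine ⟨circlePt (max (a + n) c), ⟨max (a + n) c - n, ⟨?_, ?_⟩, ?_⟩,
      ⟨max (a + n) c, ⟨le_max_right _ _, max_le h1 hcd⟩, rfl⟩⟩
    · linarith [le_max_left (a + n) c]
    · linarith [max_le (a := a + n) (b := c) (c := b + n) (by linarith) h2]
    · exact circlePt_eq_iff.2 ⟨-n, by push_cast; ring⟩

theorem IsProperHellyCircularArcGraph.nonempty_arcLift {V : Type*} {G : SimpleGraph V}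
    (hG : IsProperHellyCircularArcGraph G) : Nonempty (ArcLift G) := by
  obtain ⟨f, ⟨harc, hadj⟩, hproper, hhelly⟩ := hG
  choose lo hi h0 h1 hf using harc
  have hle : ∀ v, lo v ≤ hi v := fun v => by linarith [h0 v]
  have hint : ∀ u v, (f u ∩ f v).Nonempty ↔ ∃ n : ℤ, lo u + n ≤ hi v ∧ lo v ≤ hi u + n := by
    intro u v
    rw [hf u, hf v]
    exact circlePt_image_inter_nonempty_iff (hle u) (hle v)
  refine ⟨⟨lo, hi, hle, fun v => by linarith [h1 v], fun u v huv => ?_, ?_, ?_⟩⟩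
  · rw [hadj u v huv, hint]
  · intro u v n hl hr
    have hsub : f u ⊆ f v := by
      rw [hf u, hf v]
      rintro _ ⟨s, ⟨hs1, hs2⟩, rfl⟩
      exact ⟨s + n, ⟨by linarith, by linarith⟩, circlePt_eq_iff.2 ⟨n, rfl⟩⟩
    have hsup : f v ⊆ f u := by
      by_contra h
      exact hproper u v ⟨hsub, h⟩
    have key : ∀ x, lo v ≤ x → x ≤ hi v → lo u + n ≤ x ∧ x ≤ hi u + n := by
      intro x hx1 hx2
      have hx : circlePt x ∈ f u := hsup (by rw [hf v]; exact ⟨x, ⟨hx1, hx2⟩, rfl⟩)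
      rw [hf u] at hx
      obtain ⟨y, ⟨hy1, hy2⟩, hxy⟩ := hx
      obtain ⟨m, hm⟩ := circlePt_eq_iff.1 hxy
      have hv := h1 v
      have e1 : ((m + n : ℤ) : ℝ) < (1 : ℤ) := by push_cast; linarith
      have e2 : ((-1 : ℤ) : ℝ) < (m + n : ℤ) := by push_cast; linarith
      have e3 : m + n = 0 := by
        have := Int.cast_lt.1 e1
        have := Int.cast_lt.1 e2
        omega
      have e4 : (m : ℝ) + n = 0 := by exact_mod_cast e3
      constructor <;> linarith
    have k1 := (key (lo v) le_rfl (hle v)).1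
    have k2 := (key (hi v) (hle v) le_rfl).2
    constructor <;> linarith
  · intro u v w huv hvw huw
    rw [← hint] at huv hvw huw
    have hself : ∀ x, (f x ∩ f x).Nonempty := fun x =>
      (hint x x).2 ⟨0, by simpa using hle x, by simpa using hle x⟩
    obtain ⟨x, hx⟩ := hhelly {u, v, w} (by
      rintro a (rfl | rfl | rfl) b (rfl | rfl | rfl) <;>
        first | exact hself _ | assumption | (rw [Set.inter_comm]; assumption))
    simp only [Set.mem_insert_iff, Set.mem_singleton_iff, Set.iInter_iInter_eq_or_left,
      Set.iInter_iInter_eq_left, Set.mem_inter_iff, hf] at hx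
    obtain ⟨⟨r, hr, rfl⟩, ⟨s, hs, hrs⟩, ⟨t, ht, hrt⟩⟩ := hx
    obtain ⟨m, rfl⟩ := circlePt_eq_iff.1 hrs
    obtain ⟨n, rfl⟩ := circlePt_eq_iff.1 hrt
    exact ⟨r, 0, m, n, by simpa using hr, hs, ht⟩

/-- Real endpoints of pairwise incomparable intervals give a proper interval representation. -/
theorem isProperIntervalGraph_of_adj_iff {V : Type*} {G : SimpleGraph V} (lo hi : V → ℝ)
    (hle : ∀ v, lo v ≤ hi v)
    (hadj : ∀ u v, u ≠ v → (G.Adj u v ↔ lo u ≤ hi v ∧ lo v ≤ hi u))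
    (hproper : ∀ u v, lo v ≤ lo u → hi u ≤ hi v → lo v = lo u ∧ hi u = hi v) :
    IsProperIntervalGraph G := by
  refine ⟨fun v => Set.Icc (lo v) (hi v), ⟨fun v => ⟨lo v, hi v, hle v, rfl⟩, ?_⟩, ?_⟩
  · intro u v huv
    rw [hadj u v huv, Set.Icc_inter_Icc, Set.nonempty_Icc]
    simp only [max_le_iff, le_min_iff, hle, true_and, and_true]
    tauto
  · rintro u v ⟨h1, h2⟩
    obtain ⟨h3, h4⟩ := (Set.Icc_subset_Icc_iff (hle u)).1 h1
    obtain ⟨h5, h6⟩ := hproper u v h3 h4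
    exact h2 (Set.Icc_subset_Icc h5.ge h6.ge)

theorem IsIntervalRep.not_isInducedCycle {V : Type*} {G : SimpleGraph V} {I : V → Set ℝ}
    (hI : IsIntervalRep G I) {ℓ : ℕ} (hℓ : 4 ≤ ℓ) (f : ZMod ℓ → V) : ¬ IsInducedCycle G ℓ f := by
  rintro ⟨-, hinj, hf⟩
  obtain ⟨hicc, hadj⟩ := hI
  choose a b hab hI using hicc
  have : NeZero ℓ := ⟨by omega⟩
  obtain ⟨i, hi⟩ := Finite.exists_min (fun i => b (f i))
  have hne : ∀ k : ℕ, 0 < k → k < 4 → (k : ZMod ℓ) ≠ 0 := by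
    intro k hk hk4 h
    have := Nat.le_of_dvd hk ((ZMod.natCast_eq_zero_iff k ℓ).1 h)
    omega
  have hnb : ∀ j, G.Adj (f i) (f j) → a (f j) ≤ b (f i) := by
    intro j hj
    obtain ⟨x, hx1, hx2⟩ := (hadj _ _ hj.ne).1 hj
    rw [hI] at hx1 hx2
    exact hx2.1.trans hx1.2
  have h1 := hnb (i + 1) ((hf _ _).2 (Or.inr rfl))
  have h2 := hnb (i - 1) ((hf _ _).2 (Or.inl (by ring)))
  have h12 : f (i + 1) ≠ f (i - 1) := by
    intro h
    refine hne 2 (by norm_num) (by norm_num) ?_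
    have := hinj h
    push_cast
    linear_combination this
  have hA : G.Adj (f (i + 1)) (f (i - 1)) :=
    (hadj _ _ h12).2 ⟨b (f i), by rw [hI]; exact ⟨h1, hi _⟩, by rw [hI]; exact ⟨h2, hi _⟩⟩
  rcases (hf _ _).1 hA with h | h
  · refine hne 1 (by norm_num) (by norm_num) ?_
    push_cast
    linear_combination h
  · refine hne 3 (by norm_num) (by norm_num) ?_
    push_cast
    linear_combination -h

/-- A cyclic sequence of vertices in which the adjacencies between earlier and later
terms are exactly those of a cycle gives an induced cycle. -/
theorem isInducedCycle_of_nat {V : Type*} {G : SimpleGraph V} {n : ℕ} (hn : 3 ≤ n) (g : ℕ → V)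
    (hinj : ∀ i j, i < j → j < n → g i ≠ g j)
    (hadj : ∀ i j, i < j → j < n → (G.Adj (g i) (g j) ↔ j = i + 1 ∨ (i = 0 ∧ j + 1 = n))) :
    IsInducedCycle G n (fun x => g x.val) := by
  have : NeZero n := ⟨by omega⟩
  have : Fact (1 < n) := ⟨by omega⟩
  have hsucc : ∀ x y : ZMod n, x = y + 1 ↔
      x.val = y.val + 1 ∨ (x.val = 0 ∧ y.val + 1 = n) := by
    intro x y
    have hx := ZMod.val_lt x
    have hy := ZMod.val_lt y
    rw [← (ZMod.val_injective n).eq_iff, ZMod.val_add, ZMod.val_one]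
    rcases Nat.lt_or_ge (y.val + 1) n with h | h
    · rw [Nat.mod_eq_of_lt h]; omega
    · rw [show y.val + 1 = n by omega, Nat.mod_self]; omega
  refine ⟨hn, ?_, ?_⟩
  · intro x y hxy
    apply ZMod.val_injective n
    rcases lt_trichotomy x.val y.val with h | h | h
    · exact absurd hxy (hinj _ _ h (ZMod.val_lt y))
    · exact h
    · exact absurd hxy.symm (hinj _ _ h (ZMod.val_lt x))
  · intro x y
    have hx := ZMod.val_lt x
    have hy := ZMod.val_lt y
    rw [hsucc, hsucc]
    rcases lt_trichotomy x.val y.val with h | h | h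
    · rw [hadj _ _ h hy]; omega
    · obtain rfl := ZMod.val_injective n h
      exact iff_of_false G.irrefl (by omega)
    · rw [G.adj_comm, hadj _ _ h hx]; omega

theorem isProperIntervalGraph_of_isClique_compl {V : Type*} [Fintype V] {G : SimpleGraph V}
    (A : Set V) (hA : G.IsClique A) (hB : G.IsClique Aᶜ)
    (hG : ¬ ∃ f : ZMod 4 → V, IsInducedCycle G 4 f) : IsProperIntervalGraph G := by
  classical
  let N : V → Finset V := fun a => {b | b ∉ A ∧ G.Adj a b}
  have hN : ∀ a b, b ∈ N a ↔ b ∉ A ∧ G.Adj a b := by intro a b; simp [N]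
  have hchain : ∀ a ∈ A, ∀ a' ∈ A, (N a).card ≤ (N a').card → N a ⊆ N a' := by
    intro a ha a' ha' hcard
    by_contra hsub
    obtain ⟨b, hb, hb'⟩ := Finset.not_subset.1 hsub
    have hsub' : ¬ N a' ⊆ N a := fun h => hsub (Finset.eq_of_subset_of_card_le h hcard).ge
    obtain ⟨c, hc, hc'⟩ := Finset.not_subset.1 hsub'
    rw [hN] at hb hb' hc hc'
    have hab' : ¬ G.Adj a' b := fun h => hb' ⟨hb.1, h⟩
    have hac' : ¬ G.Adj a c := fun h => hc' ⟨hc.1, h⟩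
    have haa : a ≠ a' := by rintro rfl; exact hab' hb.2
    have hbc : b ≠ c := by rintro rfl; exact hac' hb.2
    have h1 := hA ha ha' haa
    have h2 := hB hb.1 hc.1 hbc
    let g : ℕ → V := fun i => if i = 0 then a else if i = 1 then b else if i = 2 then c else a'
    refine hG ⟨_, isInducedCycle_of_nat (by norm_num) g ?_ ?_⟩
    · intro i j hij hj
      have n1 : a ≠ b := hb.2.ne
      have n2 : a ≠ c := by rintro rfl; exact hc.1 ha
      have n3 : b ≠ a' := by rintro rfl; exact hb.1 ha'
      have n4 : c ≠ a' := hc.2.ne'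
      interval_cases j <;> interval_cases i <;> simp [g, *]
    · intro i j hij hj
      have m1 := hb.2
      have m2 := hc.2.symm
      have m3 : ¬ G.Adj b a' := fun h => hab' h.symm
      interval_cases j <;> interval_cases i <;> simp [g, *]
  let M : ℕ := Fintype.card V + 1
  let S : V → Set ℕ := fun b => {k | k = M ∨ ∃ a ∈ A, G.Adj a b ∧ (N a).card = k}
  have hS : ∀ b, sInf (S b) ∈ S b := fun b => Nat.sInf_mem ⟨M, Or.inl rfl⟩
  have hSM : ∀ b, sInf (S b) ≤ M := fun b => Nat.sInf_le (Or.inl rfl)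
  have hNM : ∀ a, (N a).card < M := fun a => Nat.lt_succ_of_le (Finset.card_le_univ _)
  have hcross : ∀ a ∈ A, ∀ b ∉ A, (G.Adj a b ↔ sInf (S b) ≤ (N a).card) := by
    intro a ha b hb
    refine ⟨fun h => Nat.sInf_le (Or.inr ⟨a, ha, h, rfl⟩), fun h => ?_⟩
    rcases hS b with h1 | ⟨a₀, ha₀, h1, h2⟩
    · have := hNM a
      omega
    · rw [← h2] at h
      exact ((hN _ _).1 (hchain a₀ ha₀ a ha h ((hN _ _).2 ⟨hb, h1⟩))).2
  let lo : V → ℝ := fun v => if v ∈ A then ((N v).card : ℝ) - M else (sInf (S v) : ℕ)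
  have hNM' : ∀ a, ((N a).card : ℝ) ≤ M := fun a => by exact_mod_cast (hNM a).le
  have hSM' : ∀ a, ((sInf (S a) : ℕ) : ℝ) ≤ M := fun a => by exact_mod_cast hSM a
  have hN0 : ∀ a, (0 : ℝ) ≤ ((N a).card : ℝ) := fun a => Nat.cast_nonneg _
  have hS0 : ∀ a, (0 : ℝ) ≤ ((sInf (S a) : ℕ) : ℝ) := fun a => Nat.cast_nonneg _
  have hM0 : (0 : ℝ) ≤ M := Nat.cast_nonneg _
  refine isProperIntervalGraph_of_adj_iff lo (fun v => lo v + M) (fun v => by linarith) ?_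
    (fun u v h1 h2 => ⟨by linarith, by linarith⟩)
  intro u v huv
  by_cases hu : u ∈ A <;> by_cases hv : v ∈ A
  · simp only [lo, hu, hv, if_true, iff_true_intro (hA hu hv huv), true_iff]
    constructor <;> linarith [hNM' u, hNM' v, hN0 u, hN0 v]
  · rw [hcross u hu v hv, ← Nat.cast_le (α := ℝ)]
    simp only [lo, hu, hv, if_true, if_false]
    constructor
    · intro h
      constructor <;> linarith [hNM' u, hS0 v]
    · rintro ⟨-, h⟩
      linarith
  · rw [G.adj_comm, hcross v hv u hu, ← Nat.cast_le (α := ℝ)]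
    simp only [lo, hu, hv, if_true, if_false]
    constructor
    · intro h
      constructor <;> linarith [hNM' v, hS0 u]
    · rintro ⟨h, -⟩
      linarith
  · simp only [lo, hu, hv, if_false, iff_true_intro (hB hu hv huv), true_iff]
    constructor <;> linarith [hSM' u, hSM' v, hS0 u, hS0 v]

namespace ArcLift

variable {V : Type*} {G : SimpleGraph V} (F : ArcLift G)

/-- The left endpoint of a translate of an arc. -/
def left (p : V × ℤ) : ℝ := F.lo p.1 + p.2

/-- The right endpoint of a translate of an arc. -/
def right (p : V × ℤ) : ℝ := F.hi p.1 + p.2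

theorem left_le_right (p : V × ℤ) : F.left p ≤ F.right p := by
  have := F.lo_le_hi p.1
  simp only [left, right]
  linarith

theorem right_lt (p : V × ℤ) : F.right p < F.left p + 1 := by
  have := F.hi_lt p.1
  simp only [left, right]
  linarith

theorem eq_of_subset {p q : V × ℤ} (h1 : F.left q ≤ F.left p) (h2 : F.right p ≤ F.right q) :
    F.left q = F.left p ∧ F.right p = F.right q := by
  simp only [left, right] at *
  have := F.proper p.1 q.1 (p.2 - q.2) (by push_cast; linarith) (by push_cast; linarith)
  push_cast at this
  constructor <;> linarith [this.1, this.2]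

theorem exists_meet_iff (p q : V × ℤ) :
    (∃ n : ℤ, F.lo p.1 + n ≤ F.hi q.1 ∧ F.lo q.1 ≤ F.hi p.1 + n) ↔
      ∃ n : ℤ, F.left p + n ≤ F.right q ∧ F.left q ≤ F.right p + n := by
  simp only [left, right]
  constructor
  · rintro ⟨n, h1, h2⟩
    exact ⟨n - p.2 + q.2, by push_cast; linarith, by push_cast; linarith⟩
  · rintro ⟨n, h1, h2⟩
    exact ⟨n + p.2 - q.2, by push_cast; linarith, by push_cast; linarith⟩

theorem helly_translate {p q r : V × ℤ}
    (hpq : ∃ n : ℤ, F.left p + n ≤ F.right q ∧ F.left q ≤ F.right p + n)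
    (hqr : ∃ n : ℤ, F.left q + n ≤ F.right r ∧ F.left r ≤ F.right q + n)
    (hpr : ∃ n : ℤ, F.left p + n ≤ F.right r ∧ F.left r ≤ F.right p + n) :
    ∃ (t : ℝ) (m n : ℤ), (F.left p ≤ t ∧ t ≤ F.right p) ∧
      (F.left q ≤ t + m ∧ t + m ≤ F.right q) ∧ (F.left r ≤ t + n ∧ t + n ≤ F.right r) := by
  obtain ⟨t, k, m, n, h1, h2, h3⟩ := F.helly p.1 q.1 r.1 ((F.exists_meet_iff p q).2 hpq)
    ((F.exists_meet_iff q r).2 hqr) ((F.exists_meet_iff p r).2 hpr)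
  simp only [left, right]
  refine ⟨t + k + p.2, m - k - p.2 + q.2, n - k - p.2 + r.2, ?_⟩
  push_cast
  refine ⟨⟨?_, ?_⟩, ⟨?_, ?_⟩, ⟨?_, ?_⟩⟩ <;> linarith [h1.1, h1.2, h2.1, h2.2, h3.1, h3.2]

/-- If some point of the circle is a right endpoint that no arc crosses, the circle can be cut. -/
theorem isProperIntervalGraph_of_gap (p : V × ℤ)
    (hp : ∀ q, F.left q ≤ F.right p → F.right q ≤ F.right p) : IsProperIntervalGraph G := by
  let c : V → V × ℤ := fun v => (v, ⌊F.right p - F.lo v⌋ + 1)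
  have hc1 : ∀ v, F.right p < F.left (c v) := by
    intro v
    have := Int.lt_floor_add_one (F.right p - F.lo v)
    simp only [left, c]
    push_cast
    linarith
  have hc2 : ∀ v, F.right (c v) ≤ F.right p + 1 := by
    intro v
    have h := Int.floor_le (F.right p - F.lo v)
    have := hp (v, ⌊F.right p - F.lo v⌋) (by simp only [left]; linarith)
    simp only [right, c] at *
    push_cast
    linarith
  refine isProperIntervalGraph_of_adj_iff (fun v => F.left (c v)) (fun v => F.right (c v))
    (fun v => F.left_le_right _) ?_ (fun u v => F.eq_of_subset)
  intro u v huv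
  rw [F.adj_iff u v huv, F.exists_meet_iff (c u) (c v)]
  constructor
  · rintro ⟨n, h1, h2⟩
    have e1 : (n : ℝ) < (1 : ℤ) := by push_cast; linarith [hc1 u, hc2 v]
    have e2 : ((-1 : ℤ) : ℝ) < n := by push_cast; linarith [hc1 v, hc2 u]
    have e3 : n = 0 := by
      have := Int.cast_lt.1 e1
      have := Int.cast_lt.1 e2
      omega
    subst e3
    simpa using And.intro h1 h2
  · rintro ⟨h1, h2⟩
    exact ⟨0, by simpa using h1, by simpa using h2⟩

/-- Arcs with translates through a common point form a clique. -/
theorem isClique_of_point (A : Set V) (x : ℝ)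
    (hx : ∀ v ∈ A, ∃ n : ℤ, F.left (v, n) ≤ x ∧ x ≤ F.right (v, n)) : G.IsClique A := by
  intro u hu v hv huv
  obtain ⟨m, hm1, hm2⟩ := hx u hu
  obtain ⟨n, hn1, hn2⟩ := hx v hv
  exact (F.adj_iff u v huv).2 ((F.exists_meet_iff (u, m) (v, n)).2
    ⟨0, by push_cast; linarith, by push_cast; linarith⟩)

theorem isProperIntervalGraph_of_two_cover [Fintype V] {p q : V × ℤ}
    (h1 : F.left q ≤ F.right p) (h2 : F.left p + 1 ≤ F.right q)
    (hG : ¬ ∃ f : ZMod 4 → V, IsInducedCycle G 4 f) : IsProperIntervalGraph G := by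
  refine isProperIntervalGraph_of_isClique_compl
    {v | ∃ n : ℤ, F.left (v, n) ≤ F.left q ∧ F.left q ≤ F.right (v, n)}
    (F.isClique_of_point _ (F.left q) fun v hv => hv)
    (F.isClique_of_point _ (F.left p + 1) fun v hv => ?_) hG
  have hfl : ∃ n : ℤ, F.left p ≤ F.left (v, n) ∧ F.left (v, n) < F.left p + 1 := by
    refine ⟨⌈F.left p - F.lo v⌉, ?_, ?_⟩
    · have := Int.le_ceil (F.left p - F.lo v)
      simp only [left] at *
      linarith
    · have := Int.ceil_lt_add_one (F.left p - F.lo v)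
      simp only [left] at *
      linarith
  obtain ⟨n, hn1, hn2⟩ := hfl
  refine ⟨n, hn2.le, ?_⟩
  rcases le_total (F.left (v, n)) (F.left q) with h | h
  · refine absurd ⟨n, h, ?_⟩ hv
    by_contra hlt
    have := F.eq_of_subset hn1 (show F.right (v, n) ≤ F.right p by linarith)
    linarith [this.2]
  · by_contra hlt
    have := F.eq_of_subset h (by linarith)
    linarith [this.2]

/-- A sequence of arcs whose first `n` members wind around the circle exactly once,
meeting only consecutively. -/
structure IsWinding (J : ℕ → V × ℤ) (n : ℕ) : Prop where
  left_mono : Monotone fun i => F.left (J i)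
  right_mono : StrictMono fun i => F.right (J i)
  left_succ_le : ∀ i, F.left (J (i + 1)) ≤ F.right (J i)
  right_lt_left : ∀ i, F.right (J i) < F.left (J (i + 2))
  wrap : F.left (J 0) + 1 ≤ F.right (J (n - 1))
  no_early_wrap : ∀ i, i + 1 < n → F.right (J i) < F.left (J 0) + 1
  no_late_wrap : F.right (J (n - 1)) < F.left (J 1) + 1

variable {F}

theorem IsWinding.isInducedCycle {J : ℕ → V × ℤ} {n : ℕ} (h : F.IsWinding J n) (hn : 3 ≤ n) :
    IsInducedCycle G n (fun x : ZMod n => (J x.val).1) := by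
  have hinj : ∀ i j, i < j → j < n → (J i).1 ≠ (J j).1 := by
    intro i j hij hj heq
    obtain ⟨k, rfl⟩ : ∃ k, j = k + 1 := ⟨j - 1, by omega⟩
    have a1 := h.left_succ_le k
    have a2 := h.no_early_wrap k hj
    have a3 := h.left_mono (Nat.zero_le i)
    have a4 := h.right_mono hij
    simp only [left, right, heq] at a1 a2 a3 a4
    have e1 : ((J (k + 1)).2 : ℝ) < ((J i).2 + 1 : ℤ) := by push_cast; linarith
    have e2 : ((J i).2 : ℝ) < (J (k + 1)).2 := by linarith
    have := Int.cast_lt.1 e1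
    have := Int.cast_lt.1 e2
    omega
  refine isInducedCycle_of_nat hn (fun i => (J i).1) hinj ?_
  intro i j hij hj
  rw [F.adj_iff _ _ (hinj i j hij hj), F.exists_meet_iff (J i) (J j)]
  constructor
  · rintro ⟨m, h1, h2⟩
    rcases lt_trichotomy m 0 with hm | rfl | hm
    · have e : (m : ℝ) ≤ (-1 : ℤ) := Int.cast_le.2 (by omega)
      push_cast at e
      linarith [h.left_mono hij.le, F.right_lt (J i)]
    · left
      by_contra hne
      have a1 := h.right_lt_left i
      have a2 := h.left_mono (show i + 2 ≤ j by omega)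
      push_cast at h2
      simp only at a2
      linarith
    · right
      have e : ((1 : ℤ) : ℝ) ≤ m := Int.cast_le.2 (by omega)
      push_cast at e
      have hj' : j + 1 = n := by
        by_contra hne
        have := h.no_early_wrap j (by omega)
        have a2 := h.left_mono (Nat.zero_le i)
        simp only at a2
        linarith
      refine ⟨?_, hj'⟩
      by_contra hi
      have a1 := h.no_late_wrap
      have a2 := h.left_mono (show 1 ≤ i by omega)
      rw [show n - 1 = j by omega] at a1
      simp only at a2
      linarith
  · rintro (rfl | ⟨rfl, hj'⟩)
    · refine ⟨0, ?_, ?_⟩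
      · have a1 := h.left_mono hij.le
        simp only at a1
        push_cast
        linarith [F.left_le_right (J (i + 1))]
      · push_cast
        linarith [h.left_succ_le i]
    · refine ⟨1, ?_, ?_⟩
      · have := h.wrap
        rw [show n - 1 = j by omega] at this
        push_cast
        linarith
      · obtain ⟨k, rfl⟩ : ∃ k, j = k + 1 := ⟨j - 1, by omega⟩
        have a1 := h.left_succ_le k
        have a2 := h.no_early_wrap k hj
        push_cast
        linarith [F.left_le_right (J 0)]

theorem IsWinding.ne_three {J : ℕ → V × ℤ} {n : ℕ} (h : F.IsWinding J n) : n ≠ 3 := by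
  rintro rfl
  have a1 := h.left_succ_le 0
  have a2 := h.left_succ_le 1
  have a3 := h.wrap
  have a4 := h.no_early_wrap 1 (by norm_num)
  have a5 := h.no_late_wrap
  have a6 := h.right_lt_left 0
  have a7 := h.left_mono (show 0 ≤ 1 by norm_num)
  have a8 := h.left_mono (show 1 ≤ 2 by norm_num)
  simp only [zero_add, Nat.reduceAdd, Nat.reduceSub] at *
  have b0 := F.left_le_right (J 0)
  have b1 := F.left_le_right (J 1)
  have b2 := F.left_le_right (J 2)
  obtain ⟨t, m, n, ⟨h1, h2⟩, ⟨h3, h4⟩, ⟨h5, h6⟩⟩ :=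
    F.helly_translate (p := J 0) (q := J 1) (r := J 2)
      ⟨0, by push_cast; linarith, by push_cast; linarith⟩
      ⟨0, by push_cast; linarith, by push_cast; linarith⟩
      ⟨1, by push_cast; linarith, by push_cast; linarith⟩
  have hm : m ≤ 0 := by
    have : (m : ℝ) < (1 : ℤ) := by push_cast; linarith
    have := Int.cast_lt.1 this
    omega
  have hm' : (m : ℝ) ≤ 0 := by exact_mod_cast hm
  have hn : n ≤ 0 := by
    have : (n : ℝ) < (1 : ℤ) := by push_cast; linarith
    have := Int.cast_lt.1 this
    omega
  have hn' : (n : ℝ) ≤ 0 := by exact_mod_cast hn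
  linarith

variable (F)

/-- When every right endpoint is crossed, greedily extending to the right winds
around the circle. -/
theorem exists_isWinding [Finite V] [Nonempty V]
    (hF : ∀ p, ∃ q, F.left q ≤ F.right p ∧ F.right p < F.right q) :
    ∃ (J : ℕ → V × ℤ) (n : ℕ), 2 ≤ n ∧ F.IsWinding J n := by
  have hgreedy : ∀ p, ∃ q, F.left q ≤ F.right p ∧ F.right p < F.right q ∧
      ∀ r, F.left r ≤ F.right p → F.right r ≤ F.right q := by
    intro p
    obtain ⟨u, hu⟩ := Finite.exists_max fun u => F.right (u, ⌊F.right p - F.lo u⌋)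
    have hmax : ∀ r, F.left r ≤ F.right p → F.right r ≤ F.right (u, ⌊F.right p - F.lo u⌋) := by
      rintro ⟨w, n⟩ hr
      refine le_trans ?_ (hu w)
      simp only [left] at hr
      have : n ≤ ⌊F.right p - F.lo w⌋ := Int.le_floor.2 (by linarith)
      have : (n : ℝ) ≤ ⌊F.right p - F.lo w⌋ := Int.cast_le.2 this
      simp only [right]
      simp only [right] at this
      linarith
    obtain ⟨q, hq1, hq2⟩ := hF p
    refine ⟨(u, ⌊F.right p - F.lo u⌋), ?_, hq2.trans_le (hmax q hq1), hmax⟩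
    have := Int.floor_le (F.right p - F.lo u)
    simp only [left]
    linarith
  choose next hnext1 hnext2 hnext3 using hgreedy
  let I : ℕ → V × ℤ := fun i => next^[i] (Classical.arbitrary V, 0)
  have hI : ∀ i, I (i + 1) = next (I i) := fun i => Function.iterate_succ_apply' _ _ _
  have left_succ_le : ∀ i, F.left (I (i + 1)) ≤ F.right (I i) := fun i => by
    rw [hI]; exact hnext1 _
  have right_mono : StrictMono fun i => F.right (I i) := strictMono_nat_of_lt_succ fun i => by
    rw [hI]; exact hnext2 _
  have left_mono : Monotone fun i => F.left (I i) := monotone_nat_of_le_succ fun i => by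
    by_contra hlt
    push Not at hlt
    have h := right_mono (Nat.lt_succ_self i)
    have := F.eq_of_subset hlt.le h.le
    linarith [this.1]
  have right_lt_left : ∀ i, F.right (I i) < F.left (I (i + 2)) := by
    intro i
    by_contra hle
    push Not at hle
    have h1 := hnext3 _ _ hle
    rw [← hI] at h1
    have h2 := right_mono (show i + 1 < i + 2 by omega)
    exact absurd h2 (not_lt.2 h1)
  have hwrap : ∃ k, F.left (I 0) + 1 ≤ F.right (I k) := by
    obtain ⟨i, j, hij, heq⟩ := Finite.exists_ne_map_eq_of_infinite fun i => (I i).1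
    wlog hlt : i < j generalizing i j
    · exact this j i hij.symm heq.symm (by omega)
    refine ⟨j, ?_⟩
    have h1 := right_mono hlt
    have h2 := left_mono (Nat.zero_le i)
    have h3 := F.lo_le_hi (I j).1
    simp only [left, right] at h1 h2 heq ⊢
    rw [heq] at h1 h2
    have e1 : ((I i).2 : ℝ) < (I j).2 := by linarith
    have e2 : (I i).2 + 1 ≤ (I j).2 := Int.cast_lt.1 e1
    have e3 : ((I i).2 : ℝ) + 1 ≤ (I j).2 := by exact_mod_cast e2
    linarith
  classical
  obtain ⟨k, hk, hmin⟩ : ∃ k, F.left (I 0) + 1 ≤ F.right (I k) ∧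
      ∀ i < k, F.right (I i) < F.left (I 0) + 1 :=
    ⟨Nat.find hwrap, Nat.find_spec hwrap, fun i hi => not_le.1 (Nat.find_min hwrap hi)⟩
  obtain ⟨l, rfl⟩ : ∃ l, k = l + 1 := by
    refine ⟨k - 1, ?_⟩
    rcases Nat.eq_zero_or_pos k with rfl | h
    · linarith [F.right_lt (I 0)]
    · omega
  by_cases hlate : F.right (I (l + 1)) < F.left (I 1) + 1
  · exact ⟨I, l + 2, by omega, left_mono, right_mono, left_succ_le, right_lt_left, hk,
      fun i hi => hmin i (by omega), hlate⟩
  · push Not at hlate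
    have hl : 1 ≤ l := by
      by_contra h
      obtain rfl : l = 0 := by omega
      linarith [F.right_lt (I 1)]
    refine ⟨fun i => I (i + 1), l + 1, by omega, fun i j hij => left_mono (by omega),
      fun i j hij => right_mono (by omega), fun i => left_succ_le _, fun i => right_lt_left _,
      hlate, fun i hi => ?_, ?_⟩
    · have h1 := hmin (i + 1) (by omega)
      have h2 := left_mono (show 0 ≤ 1 by omega)
      simp only at h2 ⊢
      linarith
    · have h1 := hmin l (by omega)
      have h2 := left_succ_le l
      have h3 := right_lt_left 0
      simp only [zero_add, Nat.reduceAdd, Nat.add_sub_cancel] at *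
      by_contra hle
      push Not at hle
      have h4 : F.left (I (l + 1)) < F.left ((I 0).1, (I 0).2 + 1) := by
        simp only [left] at *
        push_cast
        linarith
      have h5 : F.right ((I 0).1, (I 0).2 + 1) ≤ F.right (I (l + 1)) := by
        simp only [left, right] at *
        push_cast
        linarith
      have := F.eq_of_subset h4.le h5
      linarith [this.1]

end ArcLift

theorem ArcLift.isProperIntervalGraph {V : Type*} [Fintype V] {G : SimpleGraph V} (F : ArcLift G)
    (hG : ¬ ∃ (ℓ : ℕ) (f : ZMod ℓ → V), 4 ≤ ℓ ∧ IsInducedCycle G ℓ f) :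
    IsProperIntervalGraph G := by
  rcases isEmpty_or_nonempty V with hV | hV
  · exact ⟨isEmptyElim, ⟨isEmptyElim, isEmptyElim⟩, isEmptyElim⟩
  by_cases hF : ∀ p, ∃ q, F.left q ≤ F.right p ∧ F.right p < F.right q
  · obtain ⟨J, n, hn, hJ⟩ := F.exists_isWinding hF
    rcases Nat.lt_or_ge n 4 with h4 | h4
    · have := hJ.ne_three
      obtain rfl : n = 2 := by omega
      exact F.isProperIntervalGraph_of_two_cover (hJ.left_succ_le 0) hJ.wrap
        fun ⟨f, hf⟩ => hG ⟨4, f, le_rfl, hf⟩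
    · exact absurd ⟨n, _, h4, hJ.isInducedCycle (by omega)⟩ hG
  · push Not at hF
    obtain ⟨p, hp⟩ := hF
    exact F.isProperIntervalGraph_of_gap p hp

/-- A proper Helly circular-arc graph is a proper interval graph
iff it contains no hole (no induced cycle of length at least 4). -/
theorem phcag_proper_interval_iff_no_hole {V : Type*} [Fintype V] (G : SimpleGraph V)
    (hG : IsProperHellyCircularArcGraph G) :
    IsProperIntervalGraph G ↔
      ¬ ∃ (ℓ : ℕ) (f : ZMod ℓ → V), 4 ≤ ℓ ∧ IsInducedCycle G ℓ f := by
  constructor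
  · rintro ⟨I, hI, -⟩ ⟨ℓ, f, hℓ, hf⟩
    exact hI.not_isInducedCycle hℓ f hf
  · obtain ⟨F⟩ := hG.nonempty_arcLift
    exact F.isProperIntervalGraph
end

section
/- Let G be a graph with n vertices, and let G' be the graph obtained from G by adding n² new isolated vertices. Then for every natural number k, the following are equivalent: (i) there exists a set F of at most k edges of G such that G − F is a proper interval graph; (ii) there exists a set F' of at most k edges of G' such that G' − F' is a proper Helly circular-arc graph. -/
/-- The parametrization `x ↦ (cos (arctan x), sin (arctan x))` of the open right half circle. -/
noncomputable def halfCirclePt (x : ℝ) : ℝ × ℝ :=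
  circlePt (Real.arctan x / (2 * Real.pi))

lemma halfCirclePt_injective : Function.Injective halfCirclePt := by
  intro x y h
  have e : ∀ z : ℝ, 2 * Real.pi * (Real.arctan z / (2 * Real.pi)) = Real.arctan z := fun z => by
    field_simp
  simp only [halfCirclePt, circlePt, e, Prod.mk.injEq] at h
  have hmem : ∀ z : ℝ, Real.arctan z ∈ Set.Icc (-(Real.pi / 2)) (Real.pi / 2) := fun z =>
    ⟨(Real.neg_pi_div_two_lt_arctan z).le, (Real.arctan_lt_pi_div_two z).le⟩
  exact Real.arctan_injective (Real.injOn_sin (hmem x) (hmem y) h.2)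

lemma isUnitCircleArc_halfCirclePt_image {a b : ℝ} (hab : a ≤ b) :
    IsUnitCircleArc (halfCirclePt '' Set.Icc a b) := by
  have hpi := Real.pi_pos
  have hle : Real.arctan a ≤ Real.arctan b := Real.arctan_strictMono.monotone hab
  refine ⟨Real.arctan a / (2 * Real.pi), Real.arctan b / (2 * Real.pi), ?_, ?_, ?_⟩
  · rw [← sub_div]
    exact div_nonneg (by linarith) (by linarith)
  · rw [← sub_div, div_lt_one (by linarith)]
    linarith [Real.neg_pi_div_two_lt_arctan a, Real.arctan_lt_pi_div_two b]
  · have hmono : Monotone fun x : ℝ => Real.arctan x / (2 * Real.pi) := fun x y h =>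
      div_le_div_of_nonneg_right (Real.arctan_strictMono.monotone h) (by linarith)
    have hcont : Continuous fun x : ℝ => Real.arctan x / (2 * Real.pi) :=
      Real.continuous_arctan.div_const _
    have himage : (fun x : ℝ => Real.arctan x / (2 * Real.pi)) '' Set.Icc a b =
        Set.Icc (Real.arctan a / (2 * Real.pi)) (Real.arctan b / (2 * Real.pi)) :=
      Set.Subset.antisymm (Set.image_subset_iff.2 fun x hx => ⟨hmono hx.1, hmono hx.2⟩)
        (intermediate_value_Icc hab hcont.continuousOn)
    rw [← himage, Set.image_image]
    rfl

lemma circlePt_injOn (t : ℝ) : Set.InjOn circlePt (Set.Ioo t (t + 1)) := by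
  intro x hx y hy h
  simp only [circlePt, Prod.mk.injEq] at h
  have hang : ((2 * Real.pi * x : ℝ) : Real.Angle) = ((2 * Real.pi * y : ℝ) : Real.Angle) :=
    Real.Angle.cos_sin_inj h.1 h.2
  obtain ⟨n, hn⟩ := Real.Angle.angle_eq_iff_two_pi_dvd_sub.1 hang
  have hxy : x - y = n := by
    have hpi : 2 * Real.pi ≠ 0 := by positivity
    apply mul_left_cancel₀ hpi
    linarith
  have h1 : (n : ℝ) < 1 := by linarith [hx.2, hy.1]
  have h2 : (-1 : ℝ) < n := by linarith [hx.1, hy.2]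
  have hn0 : n = 0 := by
    have h1' : n < 1 := by exact_mod_cast h1
    have h2' : -1 < n := by exact_mod_cast h2
    omega
  rw [hn0, Int.cast_zero] at hxy
  linarith

lemma circlePt_add_int (t : ℝ) (n : ℤ) : circlePt (t + n) = circlePt t := by
  have e : 2 * Real.pi * (t + n) = 2 * Real.pi * t + n * (2 * Real.pi) := by ring
  simp only [circlePt, e, Real.cos_add_int_mul_two_pi, Real.sin_add_int_mul_two_pi]

/-- An arc avoiding a point lifts to an interval between two consecutive lifts of the point. -/
lemma IsUnitCircleArc.exists_lift {A : Set (ℝ × ℝ)} (hA : IsUnitCircleArc A) {t : ℝ}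
    (ht : circlePt t ∉ A) :
    ∃ a b : ℝ, a ≤ b ∧ Set.Icc a b ⊆ Set.Ioo t (t + 1) ∧ A = circlePt '' Set.Icc a b := by
  obtain ⟨a, b, hab, -, rfl⟩ := hA
  have havoid : ∀ n : ℤ, ¬ (a ≤ t + n ∧ t + n ≤ b) := fun n hn =>
    ht ⟨t + n, hn, circlePt_add_int t n⟩
  have hfloor : (⌊a - t⌋ : ℝ) ≤ a - t := Int.floor_le _
  have hlt : a - t < ⌊a - t⌋ + 1 := Int.lt_floor_add_one _
  have hne : a ≠ t + ⌊a - t⌋ := fun h => havoid ⌊a - t⌋ ⟨h.le, by linarith⟩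
  have hb : b < t + (⌊a - t⌋ + 1) := by
    by_contra! hb
    exact havoid (⌊a - t⌋ + 1) ⟨by push_cast; linarith, by push_cast; linarith⟩
  have hlow : t < a - ⌊a - t⌋ := by
    rcases lt_or_gt_of_ne hne with h | h <;> linarith
  refine ⟨a - ⌊a - t⌋, b - ⌊a - t⌋, by linarith,
    fun x hx => ⟨by linarith [hx.1], by linarith [hx.2]⟩, ?_⟩
  rw [← Set.image_sub_const_Icc, Set.image_image]
  refine Set.image_congr fun x _ => ?_
  rw [← circlePt_add_int (x - ⌊a - t⌋) ⌊a - t⌋, sub_add_cancel]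

/-- One-dimensional Helly property. -/
lemma hellyFamily_of_Icc {V : Type*} {f : V → Set ℝ}
    (hf : ∀ v, ∃ a b : ℝ, a ≤ b ∧ f v = Set.Icc a b) : HellyFamily f := by
  choose a b _ hf using hf
  intro S hS
  rcases S.eq_empty_or_nonempty with rfl | hne
  · simp
  have hle : ∀ u ∈ S, ∀ v ∈ S, a u ≤ b v := by
    intro u hu v hv
    obtain ⟨x, hxu, hxv⟩ := hS u hu v hv
    rw [hf] at hxu hxv
    exact hxu.1.trans hxv.2
  obtain ⟨w, hw⟩ := hne
  have hbdd : BddAbove (a '' S) := ⟨b w, Set.forall_mem_image.2 fun u hu => hle u hu w hw⟩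
  refine ⟨sSup (a '' S), Set.mem_iInter₂.2 fun v hv => ?_⟩
  rw [hf]
  exact ⟨le_csSup hbdd (Set.mem_image_of_mem a hv),
    csSup_le ⟨a w, Set.mem_image_of_mem a hw⟩ (Set.forall_mem_image.2 fun u hu => hle u hu v hv)⟩

lemma IsProperIntervalGraph.isProperHellyCircularArcGraph {V : Type*} {G : SimpleGraph V}
    (hG : IsProperIntervalGraph G) : IsProperHellyCircularArcGraph G := by
  obtain ⟨f, ⟨hf, hadj⟩, hproper⟩ := hG
  have hinter : ∀ u v, (halfCirclePt '' f u ∩ halfCirclePt '' f v).Nonempty ↔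
      (f u ∩ f v).Nonempty := fun u v => by
    rw [← Set.image_inter halfCirclePt_injective, Set.image_nonempty]
  refine ⟨fun v => halfCirclePt '' f v, ⟨fun v => ?_, fun u v huv => ?_⟩, fun u v h => ?_,
    fun S hS => ?_⟩
  · obtain ⟨a, b, hab, hv⟩ := hf v
    simpa only [hv] using isUnitCircleArc_halfCirclePt_image hab
  · rw [hadj u v huv, hinter]
  · exact hproper u v
      ((halfCirclePt_injective.injOn.image_ssubset_image_iff (Set.subset_univ _)
        (Set.subset_univ _)).1 h)
  · obtain ⟨x, hx⟩ := hellyFamily_of_Icc hf S fun u hu v hv => (hinter u v).1 (hS u hu v hv)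
    exact ⟨halfCirclePt x, Set.mem_iInter₂.2 fun v hv =>
      Set.mem_image_of_mem _ (Set.mem_iInter₂.1 hx v hv)⟩

/-- Adding finitely many isolated vertices preserves being a proper interval graph. -/
lemma IsProperIntervalGraph.of_isolated {V : Type*} [Finite V] {m : ℕ} {G : SimpleGraph V}
    {H : SimpleGraph (V ⊕ Fin m)} (hG : IsProperIntervalGraph G)
    (hinl : ∀ u v, H.Adj (Sum.inl u) (Sum.inl v) ↔ G.Adj u v)
    (hinr : ∀ (i : Fin m) (x : V ⊕ Fin m), ¬ H.Adj (Sum.inr i) x) :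
    IsProperIntervalGraph H := by
  obtain ⟨f, ⟨hf, hadj⟩, hproper⟩ := hG
  choose a b hab hf using hf
  obtain ⟨M, hM⟩ := (Set.finite_range b).bddAbove
  have hbM : ∀ v, b v ≤ M := fun v => hM (Set.mem_range_self v)
  have hdisj : ∀ (v : V) (i : Fin m), M + 1 + (i : ℝ) ∉ f v := fun v i h => by
    rw [hf] at h
    linarith [h.2, hbM v, (Nat.cast_nonneg (i : ℕ) : (0 : ℝ) ≤ _)]
  refine ⟨Sum.elim f fun i => {M + 1 + (i : ℝ)}, ⟨?_, ?_⟩, ?_⟩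
  · rintro (v | i)
    · exact ⟨a v, b v, hab v, hf v⟩
    · exact ⟨_, _, le_rfl, (Set.Icc_self _).symm⟩
  · rintro (u | i) (v | j) huv
    · rw [hinl, hadj u v fun h => huv (congrArg _ h)]
      rfl
    · simp [H.adj_comm (Sum.inl u), hinr, hdisj]
    · simp [hinr, hdisj]
    · have hij : i ≠ j := fun h => huv (congrArg _ h)
      simpa [hinr] using fun h : (j : ℕ) = i => hij (Fin.ext h.symm)
  · rintro (u | i) (v | j) h
    · exact hproper u v h
    · have hne : (f u).Nonempty := by
        rw [hf]
        exact Set.nonempty_Icc.2 (hab u)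
      exact hne.ne_empty (Set.ssubset_singleton_iff.1 h)
    · exact hdisj v i (Set.singleton_subset_iff.1 h.subset)
    · exact Set.singleton_ne_empty _ (Set.ssubset_singleton_iff.1 h)

/-- Cutting the circle inside the arc of an isolated vertex turns a proper circular-arc
representation of the remaining vertices into a proper interval representation. -/
lemma IsProperCircularArcGraph.isProperIntervalGraph_of_isolated {V W : Type*}
    {G : SimpleGraph V} {H : SimpleGraph W} (hH : IsProperCircularArcGraph H) (e : V ↪ W)
    (he : ∀ u v, H.Adj (e u) (e v) ↔ G.Adj u v) {w : W} (hw : ∀ v, w ≠ e v)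
    (hiso : ∀ v, ¬ H.Adj w (e v)) : IsProperIntervalGraph G := by
  obtain ⟨f, ⟨hf, hadj⟩, hproper⟩ := hH
  obtain ⟨t, s, hts, -, hfw⟩ := hf w
  have htw : circlePt t ∈ f w := by
    rw [hfw]
    exact ⟨t, ⟨le_rfl, by linarith⟩, rfl⟩
  have havoid : ∀ v, circlePt t ∉ f (e v) := fun v hv =>
    hiso v ((hadj w (e v) (hw v)).2 ⟨_, htw, hv⟩)
  choose a b hab hsub himage using fun v => (hf (e v)).exists_lift (havoid v)
  refine ⟨fun v => Set.Icc (a v) (b v), ⟨fun v => ⟨a v, b v, hab v, rfl⟩, fun u v huv => ?_⟩,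
    fun u v h => hproper (e u) (e v) ?_⟩
  · rw [← he, hadj _ _ (e.injective.ne huv), himage, himage,
      ← (circlePt_injOn t).image_inter (hsub u) (hsub v), Set.image_nonempty]
  · rw [himage, himage]
    exact ((circlePt_injOn t).image_ssubset_image_iff (hsub u) (hsub v)).2 h

lemma IsProperHellyCircularArcGraph.isProperCircularArcGraph {V : Type*} {G : SimpleGraph V}
    (hG : IsProperHellyCircularArcGraph G) : IsProperCircularArcGraph G := by
  obtain ⟨f, hf, hproper, -⟩ := hG
  exact ⟨f, hf, hproper⟩

/-- For `G'` obtained from `G` (with `n` vertices) by adding `n²`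
isolated vertices: `G` can be made a proper interval graph by deleting at most
`k` edges iff `G'` can be made a proper Helly circular-arc graph by deleting at
most `k` edges. -/
theorem edge_deletion_reduction {V : Type} [Fintype V] (G : SimpleGraph V) (k : ℕ) :
    (∃ F : Finset (Sym2 V), ↑F ⊆ G.edgeSet ∧ F.card ≤ k ∧
        IsProperIntervalGraph (G.deleteEdges ↑F)) ↔
    (∃ F' : Finset (Sym2 (V ⊕ Fin (Fintype.card V ^ 2))),
        ↑F' ⊆ (G.map (Function.Embedding.inl : V ↪ V ⊕ Fin (Fintype.card V ^ 2))).edgeSet ∧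
        F'.card ≤ k ∧
        IsProperHellyCircularArcGraph
          ((G.map (Function.Embedding.inl : V ↪ V ⊕ Fin (Fintype.card V ^ 2))).deleteEdges
            ↑F')) := by
  classical
  set ι : V ↪ V ⊕ Fin (Fintype.card V ^ 2) := Function.Embedding.inl
  have hmapinj : Function.Injective (Sym2.map ι) := Sym2.map.injective ι.injective
  have hinr : ∀ (F' : Set (Sym2 (V ⊕ Fin (Fintype.card V ^ 2)))) (i : Fin (Fintype.card V ^ 2))
      (x : V ⊕ Fin (Fintype.card V ^ 2)), ¬ ((G.map ι).deleteEdges F').Adj (Sum.inr i) x := by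
    intro F' i x h
    obtain ⟨u, v, -, hu, -⟩ := (SimpleGraph.map_adj _ _ _ _).1 (SimpleGraph.deleteEdges_adj.1 h).1
    cases hu
  constructor
  · rintro ⟨F, hF, hcard, hG⟩
    refine ⟨F.image (Sym2.map ι), ?_, Finset.card_image_le.trans hcard, ?_⟩
    · rw [Finset.coe_image, SimpleGraph.edgeSet_map]
      exact Set.image_mono hF
    · refine (hG.of_isolated (fun u v => ?_) (hinr _)).isProperHellyCircularArcGraph
      change ((G.map ι).deleteEdges _).Adj (ι u) (ι v) ↔ _
      rw [SimpleGraph.deleteEdges_adj, SimpleGraph.deleteEdges_adj, SimpleGraph.map_adj_apply,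
        Finset.coe_image, ← Sym2.map_mk, hmapinj.mem_set_image]
  · rintro ⟨F', hF', hcard, hH⟩
    refine ⟨F'.preimage (Sym2.map ι) hmapinj.injOn, fun e he => ?_, ?_, ?_⟩
    · have hmem := hF' (Finset.mem_preimage.1 he)
      rw [SimpleGraph.edgeSet_map] at hmem
      exact hmapinj.mem_set_image.1 hmem
    · rw [← Finset.card_image_of_injective _ hmapinj]
      refine (Finset.card_le_card ?_).trans hcard
      exact Finset.image_subset_iff.2 fun e he => Finset.mem_preimage.1 he
    · rcases isEmpty_or_nonempty V with hV | hV
      · exact ⟨isEmptyElim, ⟨isEmptyElim, isEmptyElim⟩, isEmptyElim⟩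
      · refine hH.isProperCircularArcGraph.isProperIntervalGraph_of_isolated ι (fun u v => ?_)
          (w := Sum.inr ⟨0, pow_pos Fintype.card_pos 2⟩) (fun _ => Sum.inr_ne_inl)
          fun v => hinr _ _ _
        rw [SimpleGraph.deleteEdges_adj, SimpleGraph.deleteEdges_adj, SimpleGraph.map_adj_apply,
          Finset.coe_preimage, Set.mem_preimage, Sym2.map_mk]
end
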